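/- Let Γ be a nonempty set and 𝕂 ∈ {ℝ, ℂ}. The Banach space c₀(Γ, 𝕂) has the Bishop-Phelps-Bollobás property for numerical radius: for every 0 < ε < 1 there exists δ > 0 such that whenever T is a bounded linear operator on c₀(Γ, 𝕂) with ν(T) = 1 and (x, x*) ∈ Π(c₀(Γ, 𝕂)) satisfies |x*(Tx)| ≥ 1 − δ, there exist a bounded linear operator S on c₀(Γ, 𝕂) with ν(S) = 1 and (y, y*) ∈ Π(c₀(Γ, 𝕂)) such that ν(T − S) ≤ ε, ‖x − y‖ ≤ ε, ‖x* − y*‖ ≤ ε, and |y*(Sy)| = 1. -/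

import Mathlib

open scoped ENNReal ZeroAtInfty

/-- The numerical radius of a bounded linear operator on `c₀(Γ, 𝕂)` (the set `Γ`
carrying the discrete topology): `ν(T) = sup {|x*(Tx)| : (x, x*) ∈ Π(c₀(Γ, 𝕂))}`,
the dual of `c₀(Γ, 𝕂)` being identified with `ℓ₁(Γ, 𝕂)` acting by
`φ(x) = ∑_{γ ∈ Γ} φ(γ) x(γ)`. -/
noncomputable def c0GammaNumRadius (Γ : Type*) [TopologicalSpace Γ] [DiscreteTopology Γ]
    (𝕂 : Type*) [RCLike 𝕂] (T : C₀(Γ, 𝕂) →L[𝕂] C₀(Γ, 𝕂)) : ℝ :=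
  sSup {r : ℝ | ∃ (x : C₀(Γ, 𝕂)) (φ : lp (fun _ : Γ => 𝕂) 1),
    ‖x‖ = 1 ∧ ‖φ‖ = 1 ∧ (∑' γ : Γ, φ γ * x γ) = 1 ∧
    r = ‖∑' γ : Γ, φ γ * (T x) γ‖}

open scoped ComplexConjugate

section C0

/-- Rotating `b` suitably makes the triangle inequality for `u` and `b` an equality. -/
theorem exists_unimodular_norm_add {𝕂 : Type*} [RCLike 𝕂] (u b : 𝕂) :
    ∃ l : 𝕂, ‖l‖ = 1 ∧ ‖u‖ + ‖b‖ = ‖u + l * b‖ := by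
  obtain ⟨c, hc, hcu⟩ := RCLike.exists_norm_eq_mul_self u
  obtain ⟨d, hd, hdb⟩ := RCLike.exists_norm_eq_mul_self b
  have hc0 : c ≠ 0 := by rintro rfl; simp at hc
  refine ⟨c⁻¹ * d, by simp [hc, hd], ?_⟩
  have h : c * (u + c⁻¹ * d * b) = ((‖u‖ + ‖b‖ : ℝ) : 𝕂) := by
    rw [RCLike.ofReal_add, hcu, hdb]
    field_simp
  have h2 := congrArg norm h
  rw [norm_mul, hc, one_mul, RCLike.norm_of_nonneg (by positivity)] at h2
  exact h2.symm

theorem RCLike.eq_ofReal_of_norm_le_re {𝕂 : Type*} [RCLike 𝕂] {z : 𝕂} {r : ℝ} (hz : ‖z‖ ≤ r)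
    (hr : r ≤ RCLike.re z) : z = (r : 𝕂) := by
  have h1 := RCLike.re_le_norm z
  have h2 : RCLike.re z = ‖z‖ := by linarith
  have h3 := RCLike.norm_sq_eq_def (z := z)
  have h4 : RCLike.im z = 0 := by
    have : RCLike.im z * RCLike.im z = 0 := by rw [h2] at h3; linarith
    simpa using this
  rw [← RCLike.re_add_im z, h4]
  simp only [map_zero, zero_mul, add_zero]
  congr 1
  linarith

theorem norm_sub_norm_le_weighted {𝕂 : Type*} [RCLike 𝕂] (u : 𝕂) {c : ℝ} (hc : 0 < c) :
    ‖(‖u‖ : 𝕂) - u‖ ≤ c * ‖u‖ + (‖u‖ - RCLike.re u) / c := by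
  have h0 : 0 ≤ ‖u‖ - RCLike.re u := sub_nonneg.2 (RCLike.re_le_norm u)
  have h1 : ‖(‖u‖ : 𝕂) - u‖ ^ 2 = 2 * ‖u‖ * (‖u‖ - RCLike.re u) := by
    have e1 := RCLike.norm_sq_eq_def (z := u)
    have e2 := RCLike.norm_sq_eq_def (z := (‖u‖ : 𝕂) - u)
    simp only [map_sub, RCLike.ofReal_re, RCLike.ofReal_im] at e2
    nlinarith
  refine (pow_le_pow_iff_left₀ (norm_nonneg _) (by positivity) two_ne_zero).1 ?_
  rw [h1]
  have h2 : (c * ‖u‖) * ((‖u‖ - RCLike.re u) / c) = ‖u‖ * (‖u‖ - RCLike.re u) := by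
    field_simp
  nlinarith [sq_nonneg (c * ‖u‖), sq_nonneg ((‖u‖ - RCLike.re u) / c)]

theorem l1_hasSum_norm {Γ 𝕂 : Type*} [RCLike 𝕂] (φ : lp (fun _ : Γ => 𝕂) 1) :
    HasSum (fun γ => ‖φ γ‖) ‖φ‖ := by
  simpa using lp.hasSum_norm (p := 1) (by simp) φ

theorem l1_norm_eq_sum {Γ 𝕂 : Type*} [RCLike 𝕂] {φ : lp (fun _ : Γ => 𝕂) 1} {B : Finset Γ}
    (h : ∀ γ ∉ B, φ γ = 0) : ‖φ‖ = ∑ γ ∈ B, ‖φ γ‖ :=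
  (l1_hasSum_norm φ).unique (hasSum_sum_of_ne_finset_zero fun γ hγ => by rw [h γ hγ, norm_zero])

variable {Γ : Type*} [TopologicalSpace Γ] {𝕂 : Type*} [RCLike 𝕂]

theorem c0_norm_apply_le (x : C₀(Γ, 𝕂)) (γ : Γ) : ‖x γ‖ ≤ ‖x‖ := by
  rw [← ZeroAtInftyContinuousMap.norm_toBCF_eq_norm]
  exact x.toBCF.norm_coe_le_norm γ

theorem c0_norm_le {x : C₀(Γ, 𝕂)} {C : ℝ} (hC : 0 ≤ C) : ‖x‖ ≤ C ↔ ∀ γ, ‖x γ‖ ≤ C := by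
  rw [← ZeroAtInftyContinuousMap.norm_toBCF_eq_norm]
  exact BoundedContinuousFunction.norm_le hC

/-- Evaluation at a point of `Γ`, as a continuous linear functional on `c₀(Γ, 𝕂)`. -/
noncomputable def c0Eval (𝕂 : Type*) [RCLike 𝕂] (γ : Γ) : C₀(Γ, 𝕂) →L[𝕂] 𝕂 :=
  LinearMap.mkContinuous
    { toFun := fun x => x γ, map_add' := fun _ _ => rfl, map_smul' := fun _ _ => rfl } 1
    fun x => by simpa using c0_norm_apply_le x γ

@[simp] theorem c0Eval_apply (γ : Γ) (x : C₀(Γ, 𝕂)) : c0Eval 𝕂 γ x = x γ := rfl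

theorem l1_norm_mul_le (φ : lp (fun _ : Γ => 𝕂) 1) (x : C₀(Γ, 𝕂)) (γ : Γ) :
    ‖φ γ * x γ‖ ≤ ‖φ γ‖ * ‖x‖ := by
  rw [norm_mul]
  exact mul_le_mul_of_nonneg_left (c0_norm_apply_le x γ) (norm_nonneg _)

theorem l1_summable_mul (φ : lp (fun _ : Γ => 𝕂) 1) (x : C₀(Γ, 𝕂)) :
    Summable fun γ => φ γ * x γ :=
  .of_norm_bounded ((l1_hasSum_norm φ).summable.mul_right ‖x‖) (l1_norm_mul_le φ x)

theorem l1_norm_tsum_mul_le (φ : lp (fun _ : Γ => 𝕂) 1) (x : C₀(Γ, 𝕂)) :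
    ‖∑' γ, φ γ * x γ‖ ≤ ‖φ‖ * ‖x‖ :=
  tsum_of_norm_bounded ((l1_hasSum_norm φ).mul_right ‖x‖) (l1_norm_mul_le φ x)

/-- A norming pair satisfies `φ(γ) x(γ) = |φ(γ)|` for every `γ`. -/
theorem l1_mul_eq_norm {x : C₀(Γ, 𝕂)} {φ : lp (fun _ : Γ => 𝕂) 1} (hx : ‖x‖ = 1)
    (hφ : ‖φ‖ = 1) (h : ∑' γ, φ γ * x γ = 1) (γ : Γ) : φ γ * x γ = (‖φ γ‖ : 𝕂) := by
  have hle : ∀ γ, ‖φ γ * x γ‖ ≤ ‖φ γ‖ := fun γ => by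
    simpa [hx] using l1_norm_mul_le φ x γ
  have h1 : HasSum (fun γ => RCLike.re (φ γ * x γ)) 1 := by
    have := (RCLike.reCLM (K := 𝕂)).hasSum (l1_summable_mul φ x).hasSum
    rw [h] at this
    simpa using this
  have h2 := (l1_hasSum_norm φ).sub h1
  rw [hφ, sub_self] at h2
  have h3 := (hasSum_zero_iff_of_nonneg fun γ =>
    sub_nonneg.2 ((RCLike.re_le_norm _).trans (hle γ))).1 h2
  have h4 := congrFun h3 γ
  refine RCLike.eq_ofReal_of_norm_le_re (hle γ) ?_
  simp only [Pi.zero_apply] at h4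
  linarith

variable [DiscreteTopology Γ]

open Classical in
/-- The canonical unit vector of `c₀(Γ, 𝕂)` at `γ`. -/
noncomputable def c0Unit (𝕂 : Type*) [RCLike 𝕂] (γ : Γ) : C₀(Γ, 𝕂) where
  toFun := Pi.single (M := fun _ => 𝕂) γ 1
  continuous_toFun := continuous_of_discreteTopology
  zero_at_infty' := by
    rw [Filter.cocompact_eq_cofinite]
    refine tendsto_const_nhds.congr' ?_
    filter_upwards [(Set.finite_singleton γ).compl_mem_cofinite] with η hη
    exact (Pi.single_eq_of_ne (M := fun _ => 𝕂) hη _).symm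

@[simp] theorem c0Unit_self (γ : Γ) : c0Unit 𝕂 γ γ = 1 := by
  classical exact Pi.single_eq_same (M := fun _ => 𝕂) γ 1

theorem c0Unit_of_ne {γ η : Γ} (h : η ≠ γ) : c0Unit 𝕂 γ η = 0 := by
  classical exact Pi.single_eq_of_ne (M := fun _ => 𝕂) h 1

theorem c0_sum_smul_unit_apply (B : Finset Γ) (c : Γ → 𝕂) (γ : Γ) [Decidable (γ ∈ B)] :
    (∑ η ∈ B, c η • c0Unit 𝕂 η) γ = if γ ∈ B then c γ else 0 := by
  classical
  rw [← c0Eval_apply, map_sum]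
  simp only [map_smul, c0Eval_apply, smul_eq_mul]
  split_ifs with h
  · rw [Finset.sum_eq_single γ]
    · simp
    · intro η _ hη
      simp [c0Unit_of_ne hη.symm]
    · exact fun h' => absurd h h'
  · refine Finset.sum_eq_zero fun η hη => ?_
    have : γ ≠ η := fun e => h (e ▸ hη)
    simp [c0Unit_of_ne this]

theorem c0_finite_lt_norm (x : C₀(Γ, 𝕂)) {r : ℝ} (hr : 0 < r) : {γ | r < ‖x γ‖}.Finite := by
  have h := x.zero_at_infty'
  rw [Filter.cocompact_eq_cofinite] at h
  have h2 := h.norm.eventually_le_const (u := r) (by simpa using hr)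
  rw [Filter.eventually_cofinite] at h2
  simpa using h2

theorem c0GammaNumRadius_le {T : C₀(Γ, 𝕂) →L[𝕂] C₀(Γ, 𝕂)} {C : ℝ} (hC : 0 ≤ C)
    (hT : ∀ z, ‖T z‖ ≤ C * ‖z‖) : c0GammaNumRadius Γ 𝕂 T ≤ C := by
  refine Real.sSup_le ?_ hC
  rintro r ⟨x, φ, hx, hφ, -, rfl⟩
  have h1 := l1_norm_tsum_mul_le φ (T x)
  have h2 := hT x
  rw [hφ, one_mul] at h1
  rw [hx, mul_one] at h2
  exact h1.trans h2

theorem le_c0GammaNumRadius (T : C₀(Γ, 𝕂) →L[𝕂] C₀(Γ, 𝕂)) {x : C₀(Γ, 𝕂)}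
    {φ : lp (fun _ : Γ => 𝕂) 1} (hx : ‖x‖ = 1) (hφ : ‖φ‖ = 1) (h : ∑' γ, φ γ * x γ = 1) :
    ‖∑' γ, φ γ * (T x) γ‖ ≤ c0GammaNumRadius Γ 𝕂 T := by
  refine le_csSup ⟨‖T‖, ?_⟩ ⟨x, φ, hx, hφ, h, rfl⟩
  rintro r ⟨x, φ, hx, hφ, -, rfl⟩
  have h1 := l1_norm_tsum_mul_le φ (T x)
  have h2 := T.le_opNorm x
  rw [hφ, one_mul] at h1
  rw [hx, mul_one] at h2
  exact h1.trans h2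

theorem norm_apply_le_c0GammaNumRadius (T : C₀(Γ, 𝕂) →L[𝕂] C₀(Γ, 𝕂)) {z : C₀(Γ, 𝕂)}
    (hz : ‖z‖ ≤ 1) (γ : Γ) : ‖(T z) γ‖ ≤ c0GammaNumRadius Γ 𝕂 T := by
  classical
  set b : 𝕂 := (T (c0Unit 𝕂 γ)) γ with hb
  set u : 𝕂 := (T z) γ - z γ * b with hu
  obtain ⟨l, hl, hlu⟩ := exists_unimodular_norm_add u b
  set x : C₀(Γ, 𝕂) := z + (l - z γ) • c0Unit 𝕂 γ with hx
  have hxγ : x γ = l := by simp [hx]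
  have hxη : ∀ η, η ≠ γ → x η = z η := fun η h => by simp [hx, c0Unit_of_ne h]
  have hx1 : ‖x‖ = 1 := by
    refine le_antisymm ((c0_norm_le zero_le_one).2 fun η => ?_) ?_
    · rcases eq_or_ne η γ with rfl | h
      · rw [hxγ, hl]
      · rw [hxη η h]
        exact (c0_norm_apply_le z η).trans hz
    · rw [← hl, ← hxγ]
      exact c0_norm_apply_le x γ
  have hTx : (T x) γ = u + l * b := by
    simp only [hx, map_add, map_smul, ZeroAtInftyContinuousMap.add_apply,
      ZeroAtInftyContinuousMap.smul_apply, smul_eq_mul, hu, hb]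
    ring
  have key : ∀ w : C₀(Γ, 𝕂),
      ∑' η, (lp.single 1 γ (conj l) : lp (fun _ : Γ => 𝕂) 1) η * w η = conj l * w γ := by
    intro w
    rw [tsum_eq_single γ]
    · simp
    · intro η hη
      simp [hη]
  have h := le_c0GammaNumRadius T (φ := lp.single 1 γ (conj l)) hx1
    (by rw [lp.norm_single (by simp), RCLike.norm_conj, hl])
    (by rw [key, hxγ, RCLike.conj_mul, hl]; simp)
  rw [key, norm_mul, RCLike.norm_conj, hl, one_mul, hTx, ← hlu] at h
  refine le_trans ?_ h
  calc ‖(T z) γ‖ = ‖u + z γ * b‖ := by simp [hu]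
    _ ≤ ‖u‖ + ‖z γ * b‖ := norm_add_le _ _
    _ ≤ ‖u‖ + ‖b‖ := by
      rw [norm_mul]
      have := mul_le_of_le_one_left (norm_nonneg b) ((c0_norm_apply_le z γ).trans hz)
      linarith

theorem norm_le_c0GammaNumRadius_mul (T : C₀(Γ, 𝕂) →L[𝕂] C₀(Γ, 𝕂)) (z : C₀(Γ, 𝕂)) :
    ‖T z‖ ≤ c0GammaNumRadius Γ 𝕂 T * ‖z‖ := by
  rcases eq_or_ne z 0 with rfl | hz
  · simp
  have hz' : 0 < ‖z‖ := norm_pos_iff.2 hz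
  have key : ∀ γ, ‖(T z) γ‖ ≤ c0GammaNumRadius Γ 𝕂 T * ‖z‖ := by
    intro γ
    have h := norm_apply_le_c0GammaNumRadius T (z := ((‖z‖⁻¹ : ℝ) : 𝕂) • z)
      (by rw [norm_smul, RCLike.norm_ofReal, abs_of_pos (inv_pos.2 hz'),
        inv_mul_cancel₀ hz'.ne']) γ
    rw [map_smul, ZeroAtInftyContinuousMap.smul_apply, norm_smul, RCLike.norm_ofReal,
      abs_of_pos (inv_pos.2 hz'), inv_mul_le_iff₀ hz'] at h
    linarith
  have hnn : 0 ≤ c0GammaNumRadius Γ 𝕂 T := by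
    refine Real.sSup_nonneg ?_
    rintro r ⟨x, φ, -, -, -, rfl⟩
    exact norm_nonneg _
  exact (c0_norm_le (by positivity)).2 key

/-- A contractive functional on `c₀(Γ, 𝕂)` almost attaining the value `a` at `x` is close to a
contractive functional attaining it at `y`, where `y` only depends on `x`. -/
theorem exists_functional_near {ε τ : ℝ} (hε : 0 < ε) (hε1 : ε < 1) (hτ : τ = ε ^ 2 / 100)
    {f : C₀(Γ, 𝕂) →L[𝕂] 𝕂} (hf : ∀ z, ‖f z‖ ≤ ‖z‖) {x y : C₀(Γ, 𝕂)} {B : Finset Γ}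
    (hx : ‖x‖ ≤ 1) (hxB : ∀ γ ∉ B, ‖x γ‖ ≤ 1 - τ) (hyB : ∀ γ ∈ B, ‖y γ‖ = 1)
    (hyx : ∀ γ ∉ B, y γ = x γ) (hxy : ‖x - y‖ ≤ τ) {a : 𝕂} (ha : ‖a‖ = 1)
    (h : 1 - τ ^ 2 ≤ RCLike.re (conj a * f x)) :
    ∃ s : C₀(Γ, 𝕂) →L[𝕂] 𝕂, (∀ z, ‖s z‖ ≤ ‖z‖) ∧ s y = a ∧
      ∀ z, ‖s z - f z‖ ≤ ε * ‖z‖ := by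
  classical
  have hτ0 : 0 < τ := by rw [hτ]; positivity
  have hτε : τ ≤ ε / 100 := by rw [hτ]; nlinarith
  have hconj : ‖conj a‖ = 1 := by rw [RCLike.norm_conj, ha]
  have hfx : 1 - τ ^ 2 ≤ ‖f x‖ := by
    refine h.trans ((RCLike.re_le_norm _).trans ?_)
    rw [norm_mul, hconj, one_mul]
  -- the part of `f` living off `B` is small
  have off1 : ∀ v : C₀(Γ, 𝕂), ‖v‖ ≤ 1 → (∀ γ ∈ B, v γ = 0) → ‖f v‖ ≤ τ := by
    intro v hv hvB
    obtain ⟨l, hl, hn_add⟩ := exists_unimodular_norm_add (f x) ((τ : 𝕂) * f v)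
    have hn' : ‖x + ((τ : 𝕂) * l) • v‖ ≤ 1 := by
      refine (c0_norm_le zero_le_one).2 fun γ => ?_
      by_cases hγ : γ ∈ B
      · simpa [hvB γ hγ] using (c0_norm_apply_le x γ).trans hx
      · rw [ZeroAtInftyContinuousMap.add_apply]
        refine (norm_add_le _ _).trans ?_
        have h1 := hxB γ hγ
        have h2 := (c0_norm_apply_le v γ).trans hv
        have h3 : ‖(((τ : 𝕂) * l) • v) γ‖ = τ * ‖v γ‖ := by
          simp [hl, abs_of_pos hτ0]
        refine (add_le_add_right h3.le _).trans ?_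
        nlinarith
    have h2 := (hf _).trans hn'
    have h3 : f (x + ((τ : 𝕂) * l) • v) = f x + l * ((τ : 𝕂) * f v) := by
      simp only [map_add, map_smul, smul_eq_mul]; ring
    rw [h3, ← hn_add, norm_mul, RCLike.norm_ofReal, abs_of_pos hτ0] at h2
    have h4 : τ * ‖f v‖ ≤ τ * τ := by nlinarith
    exact le_of_mul_le_mul_left h4 hτ0
  have off : ∀ v : C₀(Γ, 𝕂), (∀ γ ∈ B, v γ = 0) → ‖f v‖ ≤ τ * ‖v‖ := by
    intro v hvB
    rcases eq_or_ne v 0 with rfl | hv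
    · simp
    have hv' : 0 < ‖v‖ := norm_pos_iff.2 hv
    have h1 := off1 (((‖v‖⁻¹ : ℝ) : 𝕂) • v)
      (by rw [norm_smul, RCLike.norm_ofReal, abs_of_pos (inv_pos.2 hv'),
        inv_mul_cancel₀ hv'.ne']) fun γ hγ => by simp [hvB γ hγ]
    rw [map_smul, norm_smul, RCLike.norm_ofReal, abs_of_pos (inv_pos.2 hv'),
      inv_mul_le_iff₀ hv'] at h1
    linarith
  have split : ∀ z : C₀(Γ, 𝕂),
      ‖f z - ∑ η ∈ B, z η * f (c0Unit 𝕂 η)‖ ≤ τ * ‖z‖ := by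
    intro z
    have e : f z - ∑ η ∈ B, z η * f (c0Unit 𝕂 η) = f (z - ∑ η ∈ B, z η • c0Unit 𝕂 η) := by
      simp [map_sub, map_sum]
    rw [e]
    refine (off _ fun γ hγ => ?_).trans (mul_le_mul_of_nonneg_left ?_ hτ0.le)
    · rw [ZeroAtInftyContinuousMap.sub_apply, c0_sum_smul_unit_apply, if_pos hγ, sub_self]
    · refine (c0_norm_le (norm_nonneg _)).2 fun γ => ?_
      rw [ZeroAtInftyContinuousMap.sub_apply, c0_sum_smul_unit_apply]
      split_ifs
      · simp
      · simpa using c0_norm_apply_le z γ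
  set u : Γ → 𝕂 := fun η => conj a * (y η * f (c0Unit 𝕂 η)) with hu
  have hunorm : ∀ η ∈ B, ‖u η‖ = ‖f (c0Unit 𝕂 η)‖ := fun η hη => by
    simp [hu, ha, hyB η hη]
  set U : ℝ := ∑ η ∈ B, ‖u η‖ with hU
  have hU1 : U ≤ 1 := by
    choose c hc hc2 using fun η => RCLike.exists_norm_eq_mul_self (f (c0Unit 𝕂 η))
    have h1 : ‖∑ η ∈ B, c η • c0Unit 𝕂 η‖ ≤ 1 := by
      refine (c0_norm_le zero_le_one).2 fun γ => ?_
      rw [c0_sum_smul_unit_apply]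
      split_ifs
      · exact (hc γ).le
      · simp
    have h2 : f (∑ η ∈ B, c η • c0Unit 𝕂 η) = (U : 𝕂) := by
      rw [map_sum, hU, RCLike.ofReal_sum]
      refine Finset.sum_congr rfl fun η hη => ?_
      rw [map_smul, smul_eq_mul, ← hc2, hunorm η hη]
    have h3 := (hf _).trans h1
    rw [h2, RCLike.norm_ofReal] at h3
    exact (le_abs_self U).trans h3
  have hy1 : ‖y‖ ≤ 1 := by
    refine (c0_norm_le zero_le_one).2 fun γ => ?_
    by_cases hγ : γ ∈ B
    · exact (hyB γ hγ).le
    · rw [hyx γ hγ]; exact (c0_norm_apply_le x γ).trans hx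
  have hre : 1 - 3 * τ ≤ ∑ η ∈ B, RCLike.re (u η) := by
    have e : ∑ η ∈ B, RCLike.re (u η) = RCLike.re (conj a * f x)
        - RCLike.re (conj a * (f (x - y)))
        - RCLike.re (conj a * (f y - ∑ η ∈ B, y η * f (c0Unit 𝕂 η))) := by
      rw [← map_sum, ← map_sub, ← map_sub]
      congr 1
      simp only [hu, ← Finset.mul_sum, map_sub]
      ring
    have h1 : RCLike.re (conj a * (f (x - y))) ≤ τ := by
      refine (RCLike.re_le_norm _).trans ?_
      rw [norm_mul, hconj, one_mul]
      exact (hf _).trans hxy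
    have h2 : RCLike.re (conj a * (f y - ∑ η ∈ B, y η * f (c0Unit 𝕂 η))) ≤ τ := by
      refine (RCLike.re_le_norm _).trans ?_
      rw [norm_mul, hconj, one_mul]
      exact (split y).trans (mul_le_of_le_one_right hτ0.le hy1)
    rw [e]
    nlinarith
  have hUre : ∑ η ∈ B, RCLike.re (u η) ≤ U :=
    Finset.sum_le_sum fun η _ => RCLike.re_le_norm _
  have hU0 : 0 < U := by linarith
  set p : Γ → ℝ := fun η => ‖u η‖ / U with hp
  have hp1 : ∑ η ∈ B, p η = 1 := by
    rw [hp, ← Finset.sum_div, div_self hU0.ne']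
  have hp0 : ∀ η, 0 ≤ p η := fun η => by positivity
  have hpu : ∑ η ∈ B, ‖(p η : 𝕂) - u η‖ ≤ 3 * τ + (ε / 4 + 3 * τ / (ε / 4)) := by
    have h1 : ∀ η ∈ B, ‖(p η : 𝕂) - u η‖ ≤ (p η - ‖u η‖) +
        (ε / 4 * ‖u η‖ + (‖u η‖ - RCLike.re (u η)) / (ε / 4)) := by
      intro η _
      have e : (p η : 𝕂) - u η = ((p η - ‖u η‖ : ℝ) : 𝕂) + ((‖u η‖ : 𝕂) - u η) := by
        push_cast; ring
      rw [e]
      refine (norm_add_le _ _).trans (add_le_add ?_ (norm_sub_norm_le_weighted _ (by positivity)))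
      rw [RCLike.norm_of_nonneg]
      rw [sub_nonneg, hp, le_div_iff₀ hU0]
      exact mul_le_of_le_one_right (norm_nonneg _) hU1
    refine (Finset.sum_le_sum h1).trans ?_
    rw [Finset.sum_add_distrib, Finset.sum_sub_distrib, hp1, Finset.sum_add_distrib,
      ← Finset.mul_sum, ← Finset.sum_div (f := fun η => ‖u η‖ - RCLike.re (u η)),
      Finset.sum_sub_distrib, ← hU]
    have h2 : (U - ∑ η ∈ B, RCLike.re (u η)) / (ε / 4) ≤ 3 * τ / (ε / 4) := by
      gcongr; linarith
    have h3 : ε / 4 * U ≤ ε / 4 := mul_le_of_le_one_right (by positivity) hU1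
    linarith
  have hbound : τ + (3 * τ + (ε / 4 + 3 * τ / (ε / 4))) ≤ ε := by
    have : 3 * τ / (ε / 4) = 12 / 100 * ε := by rw [hτ]; field_simp; ring
    rw [this]; linarith
  have s_apply : ∀ z : C₀(Γ, 𝕂),
      (∑ η ∈ B, (a * conj (y η) * (p η : 𝕂)) • c0Eval 𝕂 η) z
        = ∑ η ∈ B, a * conj (y η) * (p η : 𝕂) * z η := by
    intro z
    simp
  refine ⟨∑ η ∈ B, (a * conj (y η) * (p η : 𝕂)) • c0Eval 𝕂 η, fun z => ?_, ?_, fun z => ?_⟩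
  · rw [s_apply]
    calc _ ≤ ∑ η ∈ B, p η * ‖z‖ := by
          refine norm_sum_le_of_le _ fun η hη => ?_
          rw [norm_mul, norm_mul, norm_mul, ha, RCLike.norm_conj, hyB η hη,
            RCLike.norm_of_nonneg (hp0 η), one_mul, one_mul]
          exact mul_le_mul_of_nonneg_left (c0_norm_apply_le z η) (hp0 η)
      _ = ‖z‖ := by rw [← Finset.sum_mul, hp1, one_mul]
  · rw [s_apply]
    calc _ = ∑ η ∈ B, a * (p η : 𝕂) := by
          refine Finset.sum_congr rfl fun η hη => ?_
          have : conj (y η) * y η = 1 := by rw [RCLike.conj_mul, hyB η hη]; simp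
          linear_combination (a * (p η : 𝕂)) * this
      _ = a := by rw [← Finset.mul_sum, ← RCLike.ofReal_sum, hp1]; simp
  · rw [s_apply]
    have e : ∑ η ∈ B, a * conj (y η) * (p η : 𝕂) * z η - f z =
        ∑ η ∈ B, a * conj (y η) * ((p η : 𝕂) - u η) * z η
          - (f z - ∑ η ∈ B, z η * f (c0Unit 𝕂 η)) := by
      have : ∑ η ∈ B, a * conj (y η) * u η * z η = ∑ η ∈ B, z η * f (c0Unit 𝕂 η) := by
        refine Finset.sum_congr rfl fun η hη => ?_
        have h1 : conj (y η) * y η = 1 := by rw [RCLike.conj_mul, hyB η hη]; simp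
        have h2 : conj a * a = 1 := by rw [RCLike.conj_mul, ha]; simp
        simp only [hu]
        linear_combination (z η * f (c0Unit 𝕂 η)) * h1 +
          (z η * f (c0Unit 𝕂 η)) * conj (y η) * y η * h2
      simp only [mul_sub, sub_mul, Finset.sum_sub_distrib, this]
      ring
    rw [e]
    have h1 : ‖∑ η ∈ B, a * conj (y η) * ((p η : 𝕂) - u η) * z η‖
        ≤ (3 * τ + (ε / 4 + 3 * τ / (ε / 4))) * ‖z‖ := by
      refine (norm_sum_le_of_le (n := fun η => ‖(p η : 𝕂) - u η‖ * ‖z‖) _ fun η hη => ?_).trans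
        ?_
      · rw [norm_mul, norm_mul, norm_mul, ha, RCLike.norm_conj, hyB η hη, one_mul, one_mul]
        exact mul_le_mul_of_nonneg_left (c0_norm_apply_le z η) (norm_nonneg _)
      · rw [← Finset.sum_mul]
        exact mul_le_mul_of_nonneg_right hpu (norm_nonneg _)
    refine (norm_sub_le _ _).trans ((add_le_add h1 (split z)).trans ?_)
    rw [← add_mul]
    exact mul_le_mul_of_nonneg_right (by linarith) (norm_nonneg _)

end C0

/-- `c₀(Γ, 𝕂)`, `𝕂 ∈ {ℝ, ℂ}`, has the Bishop–Phelps–Bollobás property for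
numerical radius. -/
theorem bpb_property_numerical_radius_c0_general
    (Γ : Type*) [Nonempty Γ] [TopologicalSpace Γ] [DiscreteTopology Γ]
    (𝕂 : Type*) [RCLike 𝕂] :
    ∀ ε : ℝ, 0 < ε → ε < 1 → ∃ δ : ℝ, 0 < δ ∧
      ∀ (T : C₀(Γ, 𝕂) →L[𝕂] C₀(Γ, 𝕂)) (x : C₀(Γ, 𝕂)) (φ : lp (fun _ : Γ => 𝕂) 1),
        c0GammaNumRadius Γ 𝕂 T = 1 →
        ‖x‖ = 1 → ‖φ‖ = 1 → (∑' γ : Γ, φ γ * x γ) = 1 →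
        1 - δ ≤ ‖∑' γ : Γ, φ γ * (T x) γ‖ →
        ∃ (S : C₀(Γ, 𝕂) →L[𝕂] C₀(Γ, 𝕂)) (y : C₀(Γ, 𝕂)) (ψ : lp (fun _ : Γ => 𝕂) 1),
          c0GammaNumRadius Γ 𝕂 S = 1 ∧ ‖y‖ = 1 ∧ ‖ψ‖ = 1 ∧
          (∑' γ : Γ, ψ γ * y γ) = 1 ∧
          c0GammaNumRadius Γ 𝕂 (T - S) ≤ ε ∧ ‖x - y‖ ≤ ε ∧ ‖φ - ψ‖ ≤ ε ∧
          ‖∑' γ : Γ, ψ γ * (S y) γ‖ = 1 := by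
  classical
  intro ε hε hε1
  obtain ⟨τ, hτ⟩ : ∃ τ : ℝ, τ = ε ^ 2 / 100 := ⟨_, rfl⟩
  have hτ0 : 0 < τ := by rw [hτ]; positivity
  have hτε : τ ≤ ε / 100 := by rw [hτ]; nlinarith
  refine ⟨τ ^ 2 * (ε / 4), by positivity, ?_⟩
  intro T x φ hT hx hφ hφx hTx
  have hTn : ∀ z, ‖T z‖ ≤ ‖z‖ := fun z => by
    simpa [hT] using norm_le_c0GammaNumRadius_mul T z
  have hφx' := l1_mul_eq_norm hx hφ hφx
  have hx1 : ∀ γ, φ γ ≠ 0 → ‖x γ‖ = 1 := by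
    intro γ hγ
    have h1 := congrArg norm (hφx' γ)
    rw [norm_mul, RCLike.norm_ofReal, abs_norm] at h1
    exact mul_left_cancel₀ (norm_ne_zero_iff.2 hγ) (h1.trans (mul_one _).symm)
  have hfin := c0_finite_lt_norm x (r := 1 - τ) (by linarith)
  set B : Finset Γ := hfin.toFinset with hB
  have hmemB : ∀ γ, γ ∈ B ↔ 1 - τ < ‖x γ‖ := fun γ => by simp [hB]
  have hφB : ∀ γ ∉ B, φ γ = 0 := by
    intro γ hγ
    by_contra h
    exact hγ ((hmemB γ).2 (by rw [hx1 γ h]; linarith))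
  -- the point `y`
  set y : C₀(Γ, 𝕂) := x + ∑ γ ∈ B, (x γ / (‖x γ‖ : 𝕂) - x γ) • c0Unit 𝕂 γ with hy
  have hyγ : ∀ γ, y γ = if γ ∈ B then x γ / (‖x γ‖ : 𝕂) else x γ := by
    intro γ
    rw [hy, ZeroAtInftyContinuousMap.add_apply, c0_sum_smul_unit_apply]
    split_ifs <;> ring
  have hxpos : ∀ γ ∈ B, 0 < ‖x γ‖ := fun γ hγ => by
    have := (hmemB γ).1 hγ
    linarith
  have hyB : ∀ γ ∈ B, ‖y γ‖ = 1 := by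
    intro γ hγ
    rw [hyγ, if_pos hγ, norm_div, RCLike.norm_ofReal, abs_norm, div_self (hxpos γ hγ).ne']
  have hyx : ∀ γ ∉ B, y γ = x γ := fun γ hγ => by rw [hyγ, if_neg hγ]
  have hyφ : ∀ γ, φ γ ≠ 0 → y γ = x γ := by
    intro γ hγ
    rw [hyγ, hx1 γ hγ]
    simp
  have hxy : ‖x - y‖ ≤ τ := by
    refine (c0_norm_le hτ0.le).2 fun γ => ?_
    rw [ZeroAtInftyContinuousMap.sub_apply]
    by_cases hγ : γ ∈ B
    · have hp := hxpos γ hγ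
      have h0 : (‖x γ‖ : 𝕂) ≠ 0 := by exact_mod_cast hp.ne'
      have e : x γ - y γ = y γ * ((‖x γ‖ - 1 : ℝ) : 𝕂) := by
        rw [hyγ, if_pos hγ]
        push_cast
        field_simp
      rw [e, norm_mul, hyB γ hγ, one_mul, RCLike.norm_ofReal, abs_le]
      have h1 := (hmemB γ).1 hγ
      have h2 := c0_norm_apply_le x γ
      constructor <;> linarith
    · rw [hyx γ hγ, sub_self, norm_zero]
      exact hτ0.le
  -- the coordinates at which `T x` is almost extremal
  obtain ⟨α, hα, hα2⟩ := RCLike.exists_norm_eq_mul_self (∑' γ, φ γ * (T x) γ)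
  set a : Γ → 𝕂 := fun γ => conj α * x γ with ha
  have hconj_a : ∀ γ, conj (a γ) = α * conj (x γ) := fun γ => by simp [ha]
  have hterm : ∀ γ, α * (φ γ * (T x) γ) = (‖φ γ‖ : 𝕂) * (conj (a γ) * (T x) γ) := by
    intro γ
    rcases eq_or_ne (φ γ) 0 with h0 | h0
    · simp [h0]
    · have h1 : x γ * conj (x γ) = 1 := by rw [RCLike.mul_conj, hx1 γ h0]; simp
      rw [← hφx' γ, hconj_a]
      linear_combination (-(φ γ * α * (T x) γ)) * h1
  have hre_le : ∀ γ, RCLike.re (conj (a γ) * (T x) γ) ≤ 1 := by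
    intro γ
    refine (RCLike.re_le_norm _).trans ?_
    rw [hconj_a, norm_mul, norm_mul, hα, RCLike.norm_conj, one_mul]
    have h1 := (c0_norm_apply_le x γ).trans hx.le
    have h2 := (c0_norm_apply_le (T x) γ).trans ((hTn x).trans hx.le)
    exact mul_le_one₀ h1 (norm_nonneg _) h2
  set A : Finset Γ :=
    {γ ∈ B | φ γ ≠ 0 ∧ 1 - τ ^ 2 ≤ RCLike.re (conj (a γ) * (T x) γ)} with hA
  have hmemA : ∀ γ, γ ∈ A ↔
      γ ∈ B ∧ φ γ ≠ 0 ∧ 1 - τ ^ 2 ≤ RCLike.re (conj (a γ) * (T x) γ) := fun γ => by simp [hA]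
  have hAB : A ⊆ B := Finset.filter_subset _ _
  set m : ℝ := ∑ γ ∈ A, ‖φ γ‖ with hm
  have hsumB : ∑ γ ∈ B, ‖φ γ‖ = 1 := by rw [← l1_norm_eq_sum hφB, hφ]
  have hsdiff : ∑ γ ∈ B \ A, ‖φ γ‖ = 1 - m := by
    have := Finset.sum_sdiff (f := fun γ => ‖φ γ‖) hAB
    linarith
  have hm_le : m ≤ 1 := by
    have : 0 ≤ ∑ γ ∈ B \ A, ‖φ γ‖ := Finset.sum_nonneg fun _ _ => norm_nonneg _
    linarith
  have hm_ge : 1 - ε / 4 ≤ m := by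
    have h1 : ‖∑' γ, φ γ * (T x) γ‖
        = ∑ γ ∈ B, ‖φ γ‖ * RCLike.re (conj (a γ) * (T x) γ) := by
      have h2 := congrArg RCLike.re hα2
      rw [RCLike.ofReal_re, tsum_eq_sum (s := B) fun γ hγ => by rw [hφB γ hγ, zero_mul],
        Finset.mul_sum, map_sum] at h2
      rw [tsum_eq_sum (s := B) fun γ hγ => by rw [hφB γ hγ, zero_mul], h2]
      refine Finset.sum_congr rfl fun γ _ => ?_
      rw [hterm, RCLike.re_ofReal_mul]
    have h3 : ∑ γ ∈ A, ‖φ γ‖ * RCLike.re (conj (a γ) * (T x) γ) ≤ m :=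
      Finset.sum_le_sum fun γ _ => mul_le_of_le_one_right (norm_nonneg _) (hre_le γ)
    have h4 : ∑ γ ∈ B \ A, ‖φ γ‖ * RCLike.re (conj (a γ) * (T x) γ)
        ≤ (1 - m) * (1 - τ ^ 2) := by
      rw [← hsdiff, Finset.sum_mul]
      refine Finset.sum_le_sum fun γ hγ => ?_
      rw [Finset.mem_sdiff, hmemA] at hγ
      rcases eq_or_ne (φ γ) 0 with h0 | h0
      · simp [h0]
      · refine mul_le_mul_of_nonneg_left ?_ (norm_nonneg _)
        by_contra! hlt
        exact hγ.2 ⟨hγ.1, h0, hlt.le⟩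
    rw [h1, ← Finset.sum_sdiff hAB] at hTx
    have h5 : τ ^ 2 * (1 - m) ≤ τ ^ 2 * (ε / 4) := by nlinarith
    have h6 := le_of_mul_le_mul_left h5 (by positivity)
    linarith
  have hm0 : 0 < m := by linarith
  -- the functional `ψ`
  obtain ⟨ψ, hψ⟩ : ∃ ψ : lp (fun _ : Γ => 𝕂) 1,
      ∀ γ, ψ γ = if γ ∈ A then φ γ / (m : 𝕂) else 0 := by
    refine ⟨∑ γ ∈ A, lp.single 1 γ (φ γ / (m : 𝕂)), fun γ => ?_⟩
    rw [lp.coeFn_sum, Finset.sum_apply]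
    simp [Pi.single_apply]
  have hψA : ∀ γ ∉ A, ψ γ = 0 := fun γ hγ => by rw [hψ, if_neg hγ]
  have hψ1 : ‖ψ‖ = 1 := by
    rw [l1_norm_eq_sum hψA]
    calc _ = ∑ γ ∈ A, ‖φ γ‖ / m := by
          refine Finset.sum_congr rfl fun γ hγ => ?_
          rw [hψ, if_pos hγ, norm_div, RCLike.norm_of_nonneg hm0.le]
      _ = 1 := by rw [← Finset.sum_div, div_self hm0.ne']
  have hψx : ∑ γ ∈ A, ψ γ * x γ = 1 := by
    calc _ = ∑ γ ∈ A, ((‖φ γ‖ / m : ℝ) : 𝕂) := by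
          refine Finset.sum_congr rfl fun γ hγ => ?_
          rw [hψ, if_pos hγ, RCLike.ofReal_div, ← hφx' γ]
          ring
      _ = 1 := by
          rw [← RCLike.ofReal_sum, ← Finset.sum_div, div_self hm0.ne', RCLike.ofReal_one]
  have hφψ : ‖φ - ψ‖ ≤ ε := by
    have h0 : ∀ γ ∉ B, (φ - ψ) γ = 0 := fun γ hγ => by
      rw [lp.coeFn_sub, Pi.sub_apply, hφB γ hγ, hψA γ fun h => hγ (hAB h), sub_zero]
    rw [l1_norm_eq_sum h0, ← Finset.sum_sdiff hAB]
    have h1 : ∑ γ ∈ B \ A, ‖(φ - ψ) γ‖ = 1 - m := by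
      rw [← hsdiff]
      refine Finset.sum_congr rfl fun γ hγ => ?_
      rw [lp.coeFn_sub, Pi.sub_apply, hψA γ (Finset.mem_sdiff.1 hγ).2, sub_zero]
    have h2 : ∑ γ ∈ A, ‖(φ - ψ) γ‖ = 1 - m := by
      calc _ = ∑ γ ∈ A, ‖φ γ‖ * (1 / m - 1) := by
            refine Finset.sum_congr rfl fun γ hγ => ?_
            have e : (φ - ψ) γ = -(φ γ * ((1 / m - 1 : ℝ) : 𝕂)) := by
              rw [lp.coeFn_sub, Pi.sub_apply, hψ, if_pos hγ]
              push_cast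
              ring
            rw [e, norm_neg, norm_mul, RCLike.norm_of_nonneg]
            rw [sub_nonneg, le_div_iff₀ hm0, one_mul]
            exact hm_le
        _ = 1 - m := by
            rw [← Finset.sum_mul, ← hm]
            field_simp
    rw [h1, h2]
    linarith
  -- the operator `S`, obtained by modifying the rows of `T` in `A`
  have hrow : ∀ γ, ∃ s : C₀(Γ, 𝕂) →L[𝕂] 𝕂, γ ∈ A →
      (∀ z, ‖s z‖ ≤ ‖z‖) ∧ s y = a γ ∧ ∀ z, ‖s z - (T z) γ‖ ≤ ε * ‖z‖ := by
    intro γ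
    by_cases hγ : γ ∈ A
    · obtain ⟨-, h0, h1⟩ := (hmemA γ).1 hγ
      obtain ⟨s, hs⟩ := exists_functional_near hε hε1 hτ (f := (c0Eval 𝕂 γ).comp T)
        (fun z => (c0_norm_apply_le (T z) γ).trans (hTn z)) hx.le
        (fun η hη => not_lt.1 fun h => hη ((hmemB η).2 h)) hyB hyx hxy
        (a := a γ) (by simp [ha, hα, hx1 γ h0]) h1
      exact ⟨s, fun _ => hs⟩
    · exact ⟨0, fun h => absurd h hγ⟩
  choose s hs using hrow
  set S : C₀(Γ, 𝕂) →L[𝕂] C₀(Γ, 𝕂) :=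
    T + ∑ γ ∈ A, (s γ - (c0Eval 𝕂 γ).comp T).smulRight (c0Unit 𝕂 γ) with hS
  have hSγ : ∀ z γ, (S z) γ = if γ ∈ A then s γ z else (T z) γ := by
    intro z γ
    have e : S z = T z + ∑ γ ∈ A, (s γ z - (T z) γ) • c0Unit 𝕂 γ := by
      simp [hS]
    rw [e, ZeroAtInftyContinuousMap.add_apply, c0_sum_smul_unit_apply]
    split_ifs <;> ring
  have hSn : ∀ z, ‖S z‖ ≤ 1 * ‖z‖ := by
    intro z
    rw [one_mul]
    refine (c0_norm_le (norm_nonneg _)).2 fun γ => ?_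
    rw [hSγ]
    split_ifs with hγ
    · exact (hs γ hγ).1 z
    · exact (c0_norm_apply_le (T z) γ).trans (hTn z)
  have hTS : ∀ z, ‖(T - S) z‖ ≤ ε * ‖z‖ := by
    intro z
    refine (c0_norm_le (by positivity)).2 fun γ => ?_
    rw [sub_apply, ZeroAtInftyContinuousMap.sub_apply, hSγ]
    split_ifs with hγ
    · rw [norm_sub_rev]
      exact (hs γ hγ).2.2 z
    · rw [sub_self, norm_zero]
      positivity
  have hψy : ∑' γ, ψ γ * y γ = 1 := by
    rw [tsum_eq_sum (s := A) fun γ hγ => by rw [hψA γ hγ, zero_mul], ← hψx]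
    exact Finset.sum_congr rfl fun γ hγ => by rw [hyφ γ ((hmemA γ).1 hγ).2.1]
  have hψS : ‖∑' γ, ψ γ * (S y) γ‖ = 1 := by
    have e : ∑' γ, ψ γ * (S y) γ = conj α := by
      rw [tsum_eq_sum (s := A) fun γ hγ => by rw [hψA γ hγ, zero_mul]]
      calc _ = ∑ γ ∈ A, conj α * (ψ γ * x γ) := by
            refine Finset.sum_congr rfl fun γ hγ => ?_
            rw [hSγ, if_pos hγ, (hs γ hγ).2.1]
            ring
        _ = conj α := by rw [← Finset.mul_sum, hψx, mul_one]
    rw [e, RCLike.norm_conj, hα]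
  have hy1 : ‖y‖ = 1 := by
    refine le_antisymm ((c0_norm_le zero_le_one).2 fun γ => ?_) ?_
    · by_cases hγ : γ ∈ B
      · exact (hyB γ hγ).le
      · rw [hyx γ hγ]
        exact (c0_norm_apply_le x γ).trans hx.le
    · have h := l1_norm_tsum_mul_le ψ y
      rwa [hψy, hψ1, norm_one, one_mul] at h
  refine ⟨S, y, ψ, le_antisymm (c0GammaNumRadius_le zero_le_one hSn) ?_, hy1, hψ1, hψy,
    c0GammaNumRadius_le hε.le hTS, hxy.trans (by linarith), hφψ, hψS⟩
  exact hψS.symm.le.trans (le_c0GammaNumRadius S hy1 hψ1 hψy)
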